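/- Suppose there exist a C² function W : ℝⁿ → ℝ with W ≥ 1, and constants λ > 0, b > 0, R > 0 such that LW(x) ≤ −λ W(x) + b·1_{|x| ≤ R}(x) for all x ∈ ℝⁿ, and suppose μ satisfies the local Poincaré inequality on B(0,R) with constant κ_R. Then for every smooth compactly supported function f, Var_μ(f) ≤ ((b κ_R + 1)/λ) ∫ |∇f|² dμ. -/

import Mathlib

open MeasureTheory Real Set
open scoped ENNReal RealInnerProductSpace

noncomputable section

abbrev En (n : ℕ) := EuclideanSpace ℝ (Fin n)

/-- The Laplacian on `ℝⁿ`: sum of second partial derivatives. -/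
def lapl {n : ℕ} (g : En n → ℝ) (x : En n) : ℝ :=
  ∑ i : Fin n,
    fderiv ℝ (fun y => fderiv ℝ g y (EuclideanSpace.single i 1)) x (EuclideanSpace.single i 1)

/-- The diffusion operator `L g = Δ g - ∇V · ∇g`. -/
def Lop {n : ℕ} (V g : En n → ℝ) (x : En n) : ℝ :=
  lapl g x - ⟪gradient V x, gradient g x⟫

/-- The Boltzmann measure `dμ = e^{-V}/Z dx`. -/
def boltz {n : ℕ} (V : En n → ℝ) : Measure (En n) :=
  (volume : Measure (En n)).withDensity
    (fun x => ENNReal.ofReal (Real.exp (-V x) / ∫ y, Real.exp (-V y)))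

theorem gradient_apply_coord {n : ℕ} (g : En n → ℝ) (x : En n) (i : Fin n) :
    gradient g x i = fderiv ℝ g x (EuclideanSpace.single i 1) := by
  have h : ⟪gradient g x, EuclideanSpace.single i (1 : ℝ)⟫
      = fderiv ℝ g x (EuclideanSpace.single i 1) := by
    simp [gradient]
  rw [← h, EuclideanSpace.inner_single_right]
  simp

theorem norm_gradient_eq {n : ℕ} (g : En n → ℝ) (x : En n) :
    ‖gradient g x‖ = ‖fderiv ℝ g x‖ := by
  simp [gradient]

theorem measurable_boltz_density {n : ℕ} {V : En n → ℝ} (hV : Continuous V) :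
    Measurable fun x => ENNReal.ofReal (Real.exp (-V x) / ∫ y, Real.exp (-V y)) := by
  fun_prop

theorem integral_boltz {n : ℕ} {V : En n → ℝ} (hV : Continuous V) (F : En n → ℝ) :
    ∫ x, F x ∂(boltz V) = (∫ y, Real.exp (-V y))⁻¹ * ∫ x, Real.exp (-V x) * F x := by
  have hZ : 0 ≤ ∫ y, Real.exp (-V y) := integral_nonneg fun _ => (Real.exp_pos _).le
  rw [boltz, integral_withDensity_eq_integral_toReal_smul₀, ← integral_const_mul]
  · refine integral_congr_ae (.of_forall fun x => ?_)
    simp only [smul_eq_mul]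
    rw [ENNReal.toReal_ofReal (by positivity)]
    ring
  · exact (measurable_boltz_density hV).aemeasurable
  · exact .of_forall fun _ => ENNReal.ofReal_lt_top

theorem isProbabilityMeasure_boltz {n : ℕ} {V : En n → ℝ}
    (hVint : Integrable (fun x => Real.exp (-V x))) : IsProbabilityMeasure (boltz V) := by
  constructor
  have hZ := integral_exp_pos hVint
  rw [boltz, withDensity_apply _ MeasurableSet.univ, Measure.restrict_univ,
    ← ofReal_integral_eq_lintegral_ofReal (hVint.div_const _)
      (.of_forall fun _ => by positivity), integral_div, div_self hZ.ne', ENNReal.ofReal_one]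

theorem boltz_ball_pos {n : ℕ} {V : En n → ℝ} (hV : Continuous V)
    (hVint : Integrable (fun x => Real.exp (-V x))) {R : ℝ} (hR : 0 < R) :
    0 < (boltz V) {x : En n | ‖x‖ ≤ R} := by
  have hZ := integral_exp_pos hVint
  have hac : (volume : Measure (En n)) ≪ boltz V := by
    refine withDensity_absolutelyContinuous' ?_ (.of_forall fun x => ?_)
    · exact (measurable_boltz_density hV).aemeasurable
    · have : 0 < Real.exp (-V x) / ∫ y, Real.exp (-V y) := by positivity
      simpa using this
  rw [pos_iff_ne_zero]
  intro h0
  have h1 : volume (Metric.closedBall (0 : En n) R) = 0 := by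
    convert hac h0 using 2
    ext x; simp
  exact (Metric.measure_closedBall_pos volume (0 : En n) hR).ne' h1

theorem lyapunov_integral_le {n : ℕ} {V W h : En n → ℝ} (hV : ContDiff ℝ 2 V)
    (hW : ContDiff ℝ 2 W) (hW0 : ∀ x, 0 < W x) (hh : ContDiff ℝ 1 h) (hc : HasCompactSupport h) :
    ∫ x, Real.exp (-V x) * (-Lop V W x * (h x ^ 2 / W x))
      ≤ ∫ x, Real.exp (-V x) * ‖gradient h x‖ ^ 2 := by
  set e : Fin n → En n := fun i => EuclideanSpace.single i 1 with he
  set D : (En n → ℝ) → Fin n → En n → ℝ := fun g i x => fderiv ℝ g x (e i) with hD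
  have hV1 : ContDiff ℝ 1 V := hV.of_le (by norm_num)
  have hW1 : ContDiff ℝ 1 W := hW.of_le (by norm_num)
  have hDW : ∀ i, ContDiff ℝ 1 (D W i) := fun i =>
    (hW.fderiv_right (m := 1) (by norm_num)).clm_apply contDiff_const
  have hDc : ∀ {g : En n → ℝ}, ContDiff ℝ 1 g → ∀ i, Continuous (D g i) := fun hg i =>
    (hg.continuous_fderiv (by norm_num)).clm_apply continuous_const
  have hVc := hV.continuous
  set u : Fin n → En n → ℝ := fun i x => Real.exp (-V x) * D W i x with hu
  set v : En n → ℝ := fun x => h x ^ 2 / W x with hv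
  have hu1 : ∀ i, ContDiff ℝ 1 (u i) := fun i => (hV1.neg.exp).mul (hDW i)
  have hv1 : ContDiff ℝ 1 v := (hh.pow 2).div hW1 fun x => (hW0 x).ne'
  have hvs : HasCompactSupport v := by
    refine hc.mono fun x hx => ?_
    contrapose! hx
    simp only [Function.mem_support, not_not] at hx
    simp [hv, hx]
  have hDu : ∀ i x, D (u i) i x = Real.exp (-V x) * (D (D W i) i x - D V i x * D W i x) := by
    intro i x
    have h1 : HasFDerivAt (u i) _ x :=
      ((hV1.differentiable (by norm_num) x).hasFDerivAt.neg.exp).mul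
        ((hDW i).differentiable (by norm_num) x).hasFDerivAt
    simp only [hD] at h1 ⊢
    rw [h1.fderiv]
    simp
    ring
  have hDv : ∀ i x, D v i x = 2 * h x * D h i x / W x - h x ^ 2 * D W i x / W x ^ 2 := by
    intro i x
    have hWd := (hW1.differentiable (by norm_num) x).hasFDerivAt
    have hhd := (hh.differentiable (by norm_num) x).hasFDerivAt
    have hWx := (hW0 x).ne'
    have h2 : HasFDerivAt (fun y => v y * W y) _ x :=
      (hv1.differentiable (by norm_num) x).hasFDerivAt.mul hWd
    have h3 : (fun y => v y * W y) = fun y => h y ^ 2 := by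
      ext y; simp only [hv]; field_simp [(hW0 y).ne']
    rw [h3] at h2
    have h4 := congrArg (fun l => l (e i)) (h2.unique (hhd.pow 2))
    simp at h4
    simp only [hD]
    simp only [hv] at h4 ⊢
    field_simp at h4 ⊢
    linarith
  have hcs : ∀ {g : En n → ℝ}, Continuous g → (∀ x, x ∉ tsupport v → g x = 0) → Integrable g := by
    intro g hg h0
    exact hg.integrable_of_hasCompactSupport (HasCompactSupport.intro hvs h0)
  have hv0 : ∀ x, x ∉ tsupport v → v x = 0 := fun x hx => image_eq_zero_of_notMem_tsupport hx
  have hDv0 : ∀ i x, x ∉ tsupport v → D v i x = 0 := fun i x hx => by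
    have : fderiv ℝ v x = 0 := image_eq_zero_of_notMem_tsupport
      (fun h' => hx (tsupport_fderiv_subset ℝ h'))
    simp [hD, this]
  have hint1 : ∀ i, Integrable (fun x => u i x * D v i x) := fun i =>
    hcs ((hu1 i).continuous.mul (hDc hv1 i)) fun x hx => by simp [hDv0 i x hx]
  have hint2 : ∀ i, Integrable (fun x => D (u i) i x * v x) := fun i =>
    hcs ((hDc (hu1 i) i).mul hv1.continuous) fun x hx => by simp [hv0 x hx]
  have hint3 : ∀ i, Integrable (fun x => u i x * v x) := fun i =>
    hcs ((hu1 i).continuous.mul hv1.continuous) fun x hx => by simp [hv0 x hx]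
  have hibp : ∀ i, ∫ x, u i x * D v i x = -∫ x, D (u i) i x * v x := fun i =>
    integral_mul_fderiv_eq_neg_fderiv_mul_of_integrable (hint2 i) (hint1 i) (hint3 i)
      (fun x _ => (hu1 i).differentiable (by norm_num) x)
      (fun x _ => hv1.differentiable (by norm_num) x)
  have hL : ∀ x, Real.exp (-V x) * (-Lop V W x * (h x ^ 2 / W x))
      = -∑ i, D (u i) i x * v x := by
    intro x
    have : ⟪gradient V x, gradient W x⟫ = ∑ i, D V i x * D W i x := by
      simp only [PiLp.inner_apply, gradient_apply_coord]
      simp [hD, he, mul_comm]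
    rw [Lop, lapl, this, ← Finset.sum_mul, Finset.sum_congr rfl fun i _ => hDu i x,
      ← Finset.mul_sum, Finset.sum_sub_distrib]
    simp only [hv, hD, he]
    ring
  have hg : ∀ x, ‖gradient h x‖ ^ 2 = ∑ i, D h i x ^ 2 := by
    intro x
    rw [EuclideanSpace.real_norm_sq_eq]
    simp only [gradient_apply_coord, hD, he]
  calc ∫ x, Real.exp (-V x) * (-Lop V W x * (h x ^ 2 / W x))
      = -∑ i, ∫ x, D (u i) i x * v x := by
        rw [integral_congr_ae (.of_forall hL), integral_neg,
          integral_finsetSum _ fun i _ => hint2 i]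
    _ = ∫ x, ∑ i, u i x * D v i x := by
        rw [integral_finsetSum _ fun i _ => hint1 i, Finset.sum_congr rfl fun i _ => hibp i,
          Finset.sum_neg_distrib]
    _ ≤ ∫ x, Real.exp (-V x) * ‖gradient h x‖ ^ 2 := by
        refine integral_mono (integrable_finsetSum _ fun i _ => hint1 i) ?_ fun x => ?_
        · refine Continuous.integrable_of_hasCompactSupport ?_ ?_
          · simp only [hg]
            exact (by fun_prop : Continuous fun x => Real.exp (-V x)).mul
              (continuous_finsetSum _ fun i _ => (hDc hh i).pow 2)
          · refine HasCompactSupport.intro (hc.fderiv ℝ) fun x hx => ?_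
            simp [norm_gradient_eq, image_eq_zero_of_notMem_tsupport hx]
        · simp only [hg, Finset.mul_sum]
          refine Finset.sum_le_sum fun i _ => ?_
          rw [hDv, hu, mul_assoc]
          refine mul_le_mul_of_nonneg_left ?_ (Real.exp_pos _).le
          have hWx := (hW0 x).ne'
          have : D h i x ^ 2 - D W i x * (2 * h x * D h i x / W x - h x ^ 2 * D W i x / W x ^ 2)
              = (D h i x - h x * D W i x / W x) ^ 2 := by
            field_simp
            ring
          nlinarith [sq_nonneg (D h i x - h x * D W i x / W x)]

theorem integrable_sq_of_hasCompactSupport {X : Type*} [TopologicalSpace X] [MeasurableSpace X]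
    [OpensMeasurableSpace X] [R1Space X] {μ : Measure X} [IsFiniteMeasureOnCompacts μ] {g : X → ℝ}
    (hg : Continuous g) (hc : HasCompactSupport g) : Integrable (fun x => g x ^ 2) μ := by
  have hs : HasCompactSupport fun x => g x ^ 2 :=
    HasCompactSupport.intro hc fun x hx => by simp [image_eq_zero_of_notMem_tsupport hx]
  exact (hg.pow 2).integrable_of_hasCompactSupport hs

theorem continuous_gradient {n : ℕ} {g : En n → ℝ} (hg : ContDiff ℝ 1 g) :
    Continuous (gradient g) :=
  (InnerProductSpace.toDual ℝ (En n)).symm.continuous.comp (hg.continuous_fderiv (by norm_num))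

theorem hasCompactSupport_gradient {n : ℕ} {g : En n → ℝ} (hg : HasCompactSupport g) :
    HasCompactSupport (gradient g) :=
  (hg.fderiv ℝ).comp_left (g := (InnerProductSpace.toDual ℝ (En n)).symm) (map_zero _)

theorem continuous_Lop {n : ℕ} {V W : En n → ℝ} (hV : ContDiff ℝ 1 V) (hW : ContDiff ℝ 2 W) :
    Continuous (Lop V W) := by
  have hlap : Continuous (lapl W) := continuous_finsetSum _ fun i _ =>
    (((hW.fderiv_right (m := 1) (by norm_num)).clm_apply contDiff_const).continuous_fderiv
      (by norm_num)).clm_apply continuous_const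
  exact hlap.sub ((continuous_gradient hV).inner (continuous_gradient (hW.of_le (by norm_num))))

theorem lyapunov_poincare_of_hasCompactSupport {n : ℕ} {V W h : En n → ℝ} (hV : ContDiff ℝ 2 V)
    (hVint : Integrable (fun x => Real.exp (-V x)))
    (hW : ContDiff ℝ 2 W) (hW1 : ∀ x, 1 ≤ W x) {lam b R : ℝ} (hb : 0 < b)
    (hLyap : ∀ x, Lop V W x ≤ -lam * W x + (if ‖x‖ ≤ R then b else 0))
    (hh : ContDiff ℝ 1 h) (hc : HasCompactSupport h) :
    lam * ∫ x, h x ^ 2 ∂(boltz V) ≤ ∫ x, ‖gradient h x‖ ^ 2 ∂(boltz V)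
      + b * ∫ x in {x : En n | ‖x‖ ≤ R}, h x ^ 2 ∂(boltz V) := by
  have := isProbabilityMeasure_boltz hVint
  have hB : MeasurableSet {x : En n | ‖x‖ ≤ R} := measurableSet_le (by fun_prop) (by fun_prop)
  have hW0 : ∀ x, 0 < W x := fun x => zero_lt_one.trans_le (hW1 x)
  have hsq : Integrable (fun x => h x ^ 2) (boltz V) :=
    integrable_sq_of_hasCompactSupport hh.continuous hc
  have hLint : Integrable (fun x => -Lop V W x * (h x ^ 2 / W x)) (boltz V) := by
    refine Continuous.integrable_of_hasCompactSupport ?_ (HasCompactSupport.intro hc fun x hx => ?_)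
    · exact (continuous_Lop (hV.of_le (by norm_num)) hW).neg.mul
        ((hh.continuous.pow 2).div hW.continuous fun x => (hW0 x).ne')
    · simp [image_eq_zero_of_notMem_tsupport hx]
  have hkey : ∫ x, -Lop V W x * (h x ^ 2 / W x) ∂(boltz V)
      ≤ ∫ x, ‖gradient h x‖ ^ 2 ∂(boltz V) := by
    rw [integral_boltz hV.continuous, integral_boltz hV.continuous]
    exact mul_le_mul_of_nonneg_left (lyapunov_integral_le hV hW hW0 hh hc)
      (inv_nonneg.2 (integral_exp_pos hVint).le)
  have hmono : ∫ x, (lam * h x ^ 2 - b * {x : En n | ‖x‖ ≤ R}.indicator (fun x => h x ^ 2) x)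
      ∂(boltz V) ≤ ∫ x, -Lop V W x * (h x ^ 2 / W x) ∂(boltz V) := by
    refine integral_mono ((hsq.const_mul _).sub ((hsq.indicator hB).const_mul _)) hLint fun x => ?_
    have h1 := mul_le_mul_of_nonneg_right (hLyap x) (div_nonneg (sq_nonneg (h x)) (hW0 x).le)
    have h2 : h x ^ 2 / W x ≤ h x ^ 2 := div_le_self (sq_nonneg _) (hW1 x)
    have h3 : W x * (h x ^ 2 / W x) = h x ^ 2 := mul_div_cancel₀ _ (hW0 x).ne'
    have h4 : lam * W x * (h x ^ 2 / W x) = lam * h x ^ 2 := by rw [mul_assoc, h3]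
    generalize h x ^ 2 / W x = q at h1 h2 h4 ⊢
    by_cases hx : ‖x‖ ≤ R
    · simp only [hx, if_true, indicator, mem_ofPred_eq] at h1 ⊢
      nlinarith [mul_le_mul_of_nonneg_left h2 hb.le, h4]
    · simp only [hx, if_false, indicator, mem_ofPred_eq] at h1 ⊢
      linarith
  rw [integral_sub (hsq.const_mul _) ((hsq.indicator hB).const_mul _), integral_const_mul,
    integral_const_mul, integral_indicator hB] at hmono
  linarith

theorem norm_gradient_mul_le {n : ℕ} {p q : En n → ℝ} (x : En n) (hp : DifferentiableAt ℝ p x)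
    (hq : DifferentiableAt ℝ q x) :
    ‖gradient (fun y => p y * q y) x‖ ≤ |p x| * ‖gradient q x‖ + |q x| * ‖gradient p x‖ := by
  simp only [norm_gradient_eq]
  rw [fderiv_fun_mul hp hq]
  refine (norm_add_le _ _).trans_eq ?_
  simp [norm_smul]

theorem lyapunov_poincare_sub_const {n : ℕ} {V W f : En n → ℝ} (hV : ContDiff ℝ 2 V)
    (hVint : Integrable (fun x => Real.exp (-V x)))
    (hW : ContDiff ℝ 2 W) (hW1 : ∀ x, 1 ≤ W x) {lam b R : ℝ} (hb : 0 < b)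
    (hLyap : ∀ x, Lop V W x ≤ -lam * W x + (if ‖x‖ ≤ R then b else 0))
    (hf : ContDiff ℝ 1 f) (hfc : HasCompactSupport f) (c : ℝ) :
    lam * ∫ x, (f x - c) ^ 2 ∂(boltz V) ≤ ∫ x, ‖gradient f x‖ ^ 2 ∂(boltz V)
      + b * ∫ x in {x : En n | ‖x‖ ≤ R}, (f x - c) ^ 2 ∂(boltz V) := by
  have := isProbabilityMeasure_boltz hVint
  have hfcont := hf.continuous
  obtain ⟨F, hF⟩ := hfcont.bounded_above_of_compact_support hfc
  set G : ℝ := F + |c|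
  have hG : ∀ x, |f x - c| ≤ G := fun x =>
    (abs_sub _ _).trans (add_le_add (by simpa using hF x) le_rfl)
  have hG0 : 0 ≤ G := (abs_nonneg _).trans (hG 0)
  let φ : ContDiffBump (0 : En n) := ⟨1, 2, one_pos, one_lt_two⟩
  have hφ : ContDiff ℝ 1 φ := φ.contDiff
  obtain ⟨M, hM⟩ := (hφ.continuous_fderiv (by norm_num)).bounded_above_of_compact_support
    (φ.hasCompactSupport.fderiv ℝ)
  set r : ℕ → ℝ := fun k => 1 / ((k : ℝ) + 1) with hr
  have hr0 : ∀ k, 0 < r k := fun k => by simp only [hr]; positivity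
  have hrlim : Filter.Tendsto r Filter.atTop (nhds 0) := tendsto_one_div_add_atTop_nhds_zero_nat
  set χ : ℕ → En n → ℝ := fun k x => φ (r k • x)
  have hχ1 : ∀ k, ContDiff ℝ 1 (χ k) := fun k => hφ.comp (contDiff_const_smul _)
  have hχc : ∀ k, HasCompactSupport (χ k) := fun k =>
    φ.hasCompactSupport.comp_homeomorph (Homeomorph.smulOfNeZero (r k) (hr0 k).ne')
  have hχg : ∀ k x, ‖gradient (χ k) x‖ ≤ r k * M := by
    intro k x
    have h1 : HasFDerivAt (χ k) _ x :=
      ((hφ.differentiable (by norm_num) (r k • x)).hasFDerivAt).comp x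
        ((hasFDerivAt_id x).const_smul (r k))
    rw [norm_gradient_eq, h1.fderiv, ContinuousLinearMap.comp_smul, norm_smul, Real.norm_eq_abs,
      abs_of_pos (hr0 k)]
    exact mul_le_mul_of_nonneg_left (by simpa using hM (r k • x)) (hr0 k).le
  have hχabs : ∀ k x, |χ k x| ≤ 1 := fun k x => by
    rw [abs_of_nonneg φ.nonneg]; exact φ.le_one
  have hgd : ∀ x, gradient (fun y => f y - c) x = gradient f x := fun x => by
    simp [gradient, fderiv_sub_const]
  have hgC : ContDiff ℝ 1 (fun y => f y - c) := hf.sub contDiff_const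
  have hbdd : ∀ k x, (χ k x * (f x - c)) ^ 2 ≤ (f x - c) ^ 2 := fun k x => by
    rw [mul_pow]
    exact mul_le_of_le_one_left (sq_nonneg _) ((sq_le_one_iff_abs_le_one _).2 (hχabs k x))
  have hgsq : Integrable (fun x => (f x - c) ^ 2) (boltz V) :=
    Integrable.of_bound (by fun_prop) (G ^ 2) (.of_forall fun x => by
      rw [Real.norm_eq_abs, abs_pow]
      exact pow_le_pow_left₀ (abs_nonneg _) (hG x) 2)
  have hgrad : Integrable (fun x => ‖gradient f x‖) (boltz V) :=
    (continuous_gradient hf).norm.integrable_of_hasCompactSupport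
      (hasCompactSupport_gradient hfc).norm
  have hgrad2 : Integrable (fun x => ‖gradient f x‖ ^ 2) (boltz V) :=
    integrable_sq_of_hasCompactSupport (continuous_gradient hf).norm
      (hasCompactSupport_gradient hfc).norm
  have hcut : ∀ k, lam * ∫ x, (χ k x * (f x - c)) ^ 2 ∂(boltz V)
      ≤ (∫ x, ‖gradient f x‖ ^ 2 ∂(boltz V)
          + 2 * (G * (r k * M)) * ∫ x, ‖gradient f x‖ ∂(boltz V) + (G * (r k * M)) ^ 2)
        + b * ∫ x in {x : En n | ‖x‖ ≤ R}, (f x - c) ^ 2 ∂(boltz V) := by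
    intro k
    have hhC : ContDiff ℝ 1 (fun x => χ k x * (f x - c)) := (hχ1 k).mul hgC
    have hhc : HasCompactSupport (fun x => χ k x * (f x - c)) := (hχc k).mul_right
    refine (lyapunov_poincare_of_hasCompactSupport hV hVint hW hW1 hb hLyap hhC hhc).trans
      (add_le_add ?_ (mul_le_mul_of_nonneg_left ?_ hb.le))
    · have hexp : ∫ x, (‖gradient f x‖ ^ 2 + 2 * (G * (r k * M)) * ‖gradient f x‖
            + (G * (r k * M)) ^ 2) ∂(boltz V)
          = ∫ x, ‖gradient f x‖ ^ 2 ∂(boltz V)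
            + 2 * (G * (r k * M)) * ∫ x, ‖gradient f x‖ ∂(boltz V) + (G * (r k * M)) ^ 2 := by
        rw [integral_add (f := fun x => ‖gradient f x‖ ^ 2 + 2 * (G * (r k * M)) * ‖gradient f x‖)
          (hgrad2.add (hgrad.const_mul _)) (integrable_const _),
          integral_add hgrad2 (hgrad.const_mul _), integral_const_mul]
        simp
      rw [← hexp]
      refine integral_mono_of_nonneg (.of_forall fun x => sq_nonneg _)
        ((hgrad2.add (hgrad.const_mul _)).add (integrable_const _)) (.of_forall fun x => ?_)
      have h1 : ‖gradient (fun y => χ k y * (f y - c)) x‖ ≤ ‖gradient f x‖ + G * (r k * M) := by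
        refine (norm_gradient_mul_le x ((hχ1 k).differentiable (by norm_num) x)
          (hgC.differentiable (by norm_num) x)).trans (add_le_add ?_ ?_)
        · rw [hgd]
          exact mul_le_of_le_one_left (norm_nonneg _) (hχabs k x)
        · exact mul_le_mul (hG x) (hχg k x) (norm_nonneg _) hG0
      calc ‖gradient (fun y => χ k y * (f y - c)) x‖ ^ 2
          ≤ (‖gradient f x‖ + G * (r k * M)) ^ 2 := pow_le_pow_left₀ (norm_nonneg _) h1 2
        _ = _ := by ring
    · exact integral_mono_of_nonneg (.of_forall fun x => sq_nonneg _) hgsq.integrableOn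
        (.of_forall fun x => hbdd k x)
  have hlim1 : Filter.Tendsto (fun k => lam * ∫ x, (χ k x * (f x - c)) ^ 2 ∂(boltz V))
      Filter.atTop (nhds (lam * ∫ x, (f x - c) ^ 2 ∂(boltz V))) := by
    refine (tendsto_integral_of_dominated_convergence
      (F := fun k x => (χ k x * (f x - c)) ^ 2) (fun x => (f x - c) ^ 2)
      (fun k => (((hχ1 k).mul hgC).continuous.pow 2).aestronglyMeasurable) hgsq
      (fun k => .of_forall fun x => ?_) (.of_forall fun x => ?_)).const_mul lam
    · rw [Real.norm_of_nonneg (sq_nonneg _)]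
      exact hbdd k x
    · have h1 : Filter.Tendsto (fun k => χ k x) Filter.atTop (nhds 1) := by
        have h0 : φ (0 : En n) = 1 := φ.one_of_mem_closedBall (by simp [φ])
        have h2 := (hφ.continuous.tendsto (0 : En n)).comp
          (by simpa using hrlim.smul_const x :
            Filter.Tendsto (fun k => r k • x) Filter.atTop (nhds (0 : En n)))
        rwa [h0] at h2
      simpa using (h1.mul_const (f x - c)).pow 2
  refine le_of_tendsto_of_tendsto' hlim1 ?_ hcut
  have hε : Filter.Tendsto (fun k => G * (r k * M)) Filter.atTop (nhds 0) := by
    simpa using (hrlim.mul_const M).const_mul G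
  simpa using ((((hε.const_mul 2).mul_const (∫ x, ‖gradient f x‖ ∂(boltz V))).const_add
    (∫ x, ‖gradient f x‖ ^ 2 ∂(boltz V))).add (hε.pow 2)).add_const
    (b * ∫ x in {x : En n | ‖x‖ ≤ R}, (f x - c) ^ 2 ∂(boltz V))

theorem setIntegral_sub_const_sq {α : Type*} [MeasurableSpace α] {μ : Measure α}
    [IsFiniteMeasure μ] {f : α → ℝ} (hf : Integrable f μ) (hf2 : Integrable (fun x => f x ^ 2) μ)
    (s : Set α) (c : ℝ) :
    ∫ x in s, (f x - c) ^ 2 ∂μ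
      = ∫ x in s, f x ^ 2 ∂μ - 2 * c * ∫ x in s, f x ∂μ + c ^ 2 * μ.real s := by
  have h : ∀ x, (f x - c) ^ 2 = f x ^ 2 - 2 * c * f x + c ^ 2 := fun x => by ring
  simp only [h]
  have h1 : Integrable (fun x => 2 * c * f x) (μ.restrict s) := hf.integrableOn.const_mul _
  have h2 : Integrable (fun x => f x ^ 2 - 2 * c * f x) (μ.restrict s) := hf2.integrableOn.sub h1
  rw [integral_add h2 (integrable_const _), integral_sub hf2.integrableOn h1, integral_const_mul]
  simp [mul_comm]

/-- a linear Lyapunov condition `LW ≤ -λW + b 1_{|x|≤R}` together with a local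
Poincaré inequality on `B(0,R)` implies the Poincaré inequality
`Var_μ(f) ≤ ((bκ_R + 1)/λ) ∫ |∇f|² dμ`. -/
theorem stmt2 {n : ℕ} (hn : 0 < n) (V : En n → ℝ) (hV : ContDiff ℝ 2 V)
    (hVint : Integrable (fun x => Real.exp (-V x)))
    (W : En n → ℝ) (hW : ContDiff ℝ 2 W) (hW1 : ∀ x, 1 ≤ W x)
    (lam b R : ℝ) (hlam : 0 < lam) (hb : 0 < b) (hR : 0 < R)
    (hLyap : ∀ x, Lop V W x ≤ -lam * W x + (if ‖x‖ ≤ R then b else 0))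
    (κ : ℝ)
    (hloc : ∀ f : En n → ℝ, ContDiff ℝ (⊤ : ℕ∞) f → HasCompactSupport f →
      ∫ x in {x : En n | ‖x‖ ≤ R}, (f x) ^ 2 ∂(boltz V)
        ≤ κ * ∫ x, ‖gradient f x‖ ^ 2 ∂(boltz V)
          + ((boltz V) {x : En n | ‖x‖ ≤ R}).toReal⁻¹
              * (∫ x in {x : En n | ‖x‖ ≤ R}, f x ∂(boltz V)) ^ 2)
    (f : En n → ℝ) (hf : ContDiff ℝ (⊤ : ℕ∞) f) (hfc : HasCompactSupport f) :
    ∫ x, (f x) ^ 2 ∂(boltz V) - (∫ x, f x ∂(boltz V)) ^ 2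
      ≤ ((b * κ + 1) / lam) * ∫ x, ‖gradient f x‖ ^ 2 ∂(boltz V) := by
  have := isProbabilityMeasure_boltz hVint
  have hf1 : ContDiff ℝ 1 f := hf.of_le (by exact_mod_cast le_top)
  have hfi : Integrable f (boltz V) := hf.continuous.integrable_of_hasCompactSupport hfc
  have hfi2 : Integrable (fun x => f x ^ 2) (boltz V) :=
    integrable_sq_of_hasCompactSupport hf.continuous hfc
  set B : Set (En n) := {x : En n | ‖x‖ ≤ R}
  have hBpos : 0 < (boltz V).real B :=
    ENNReal.toReal_pos (boltz_ball_pos hV.continuous hVint hR).ne' (measure_ne_top _ _)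
  set c : ℝ := (∫ x in B, f x ∂(boltz V)) / (boltz V).real B with hc
  have hglobal := lyapunov_poincare_sub_const hV hVint hW hW1 hb hLyap hf1 hfc c
  have hlocal : ∫ x in B, (f x - c) ^ 2 ∂(boltz V) ≤ κ * ∫ x, ‖gradient f x‖ ^ 2 ∂(boltz V) := by
    have h1 := hloc f hf hfc
    change _ ≤ _ + ((boltz V).real B)⁻¹ * _ at h1
    rw [setIntegral_sub_const_sq hfi hfi2]
    have h2 : 2 * c * ∫ x in B, f x ∂(boltz V)
        = 2 * (((boltz V).real B)⁻¹ * (∫ x in B, f x ∂(boltz V)) ^ 2) := by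
      rw [hc]; ring
    have h3 : c ^ 2 * (boltz V).real B
        = ((boltz V).real B)⁻¹ * (∫ x in B, f x ∂(boltz V)) ^ 2 := by
      rw [hc]; field_simp
    linarith
  have hvar : ∫ x, f x ^ 2 ∂(boltz V) - (∫ x, f x ∂(boltz V)) ^ 2
      ≤ ∫ x, (f x - c) ^ 2 ∂(boltz V) := by
    have h1 := setIntegral_sub_const_sq hfi hfi2 univ c
    simp only [Measure.restrict_univ, probReal_univ] at h1
    nlinarith [sq_nonneg ((∫ x, f x ∂(boltz V)) - c)]
  rw [div_mul_eq_mul_div, le_div_iff₀ hlam]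
  nlinarith [mul_le_mul_of_nonneg_left hvar hlam.le, mul_le_mul_of_nonneg_left hlocal hb.le]
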